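/- Under the standing assumptions, the family {c_Q : Q is an interior square of S} is a basis of the kernel of the linear map c ↦ Dc on the space of functions c : ℤ×ℤ → ℝ×ℝ supported on the interior vertices; that is, these functions are linearly independent and span {c supported on the interior vertices : (Dc)(Q') = 0 for every square Q' of S}. -/

import Mathlib

/-- The closed unit square `[i,i+1] × [j,j+1] ⊆ ℝ²` indexed by `q = (i,j) ∈ ℤ × ℤ`. -/
def unitSq (q : ℤ × ℤ) : Set (ℝ × ℝ) :=
  Set.Icc (q.1 : ℝ) (q.1 + 1) ×ˢ Set.Icc (q.2 : ℝ) (q.2 + 1)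

/-- `Ω̄`, the union of the closed squares of the mesh `S`. -/
def meshRegion (S : Finset (ℤ × ℤ)) : Set (ℝ × ℝ) := ⋃ q ∈ S, unitSq q

/-- `v` is an interior vertex of `S`: all four grid squares having `v` as a corner belong
to `S`. -/
abbrev interiorVertex (S : Finset (ℤ × ℤ)) (v : ℤ × ℤ) : Prop :=
  (v.1 - 1, v.2 - 1) ∈ S ∧ (v.1 - 1, v.2) ∈ S ∧ (v.1, v.2 - 1) ∈ S ∧ v ∈ S

/-- `v` is a mesh vertex of `S`: it is a corner of some square of `S`. -/
abbrev meshVertex (S : Finset (ℤ × ℤ)) (v : ℤ × ℤ) : Prop :=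
  (v.1 - 1, v.2 - 1) ∈ S ∨ (v.1 - 1, v.2) ∈ S ∨ (v.1, v.2 - 1) ∈ S ∨ v ∈ S

/-- `v` is a boundary vertex of `S`: a mesh vertex which is not interior. -/
abbrev boundaryVertex (S : Finset (ℤ × ℤ)) (v : ℤ × ℤ) : Prop :=
  meshVertex S v ∧ ¬ interiorVertex S v

/-- The four corners of the square indexed by `q`. -/
def cornersF (q : ℤ × ℤ) : Finset (ℤ × ℤ) :=
  {q, (q.1 + 1, q.2), (q.1, q.2 + 1), (q.1 + 1, q.2 + 1)}

/-- `q` is an interior square: all four of its corners are interior vertices. -/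
abbrev interiorSquare (S : Finset (ℤ × ℤ)) (q : ℤ × ℤ) : Prop :=
  interiorVertex S q ∧ interiorVertex S (q.1 + 1, q.2) ∧
    interiorVertex S (q.1, q.2 + 1) ∧ interiorVertex S (q.1 + 1, q.2 + 1)

/-- The square `(i,j)` is red if `i + j` is even (and black otherwise). -/
abbrev isRed (q : ℤ × ℤ) : Prop := (q.1 + q.2) % 2 = 0

/-- The standing assumptions on the mesh `S`: it is nonempty, `Ω` is connected and simply
connected, no square has four boundary corners, every grid edge shared by two squares of `S`
has an interior endpoint, and no square has exactly two boundary corners lying at diagonally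
opposite corners. -/
structure Standing (S : Finset (ℤ × ℤ)) : Prop where
  nonempty : S.Nonempty
  connected : IsConnected (interior (meshRegion S))
  simplyConnected : SimplyConnectedSpace ↥(interior (meshRegion S))
  noFourBoundary : ∀ q ∈ S,
    ¬ (boundaryVertex S q ∧ boundaryVertex S (q.1 + 1, q.2) ∧
        boundaryVertex S (q.1, q.2 + 1) ∧ boundaryVertex S (q.1 + 1, q.2 + 1))
  edgeH : ∀ v : ℤ × ℤ, v ∈ S → (v.1, v.2 - 1) ∈ S →
    interiorVertex S v ∨ interiorVertex S (v.1 + 1, v.2)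
  edgeV : ∀ v : ℤ × ℤ, v ∈ S → (v.1 - 1, v.2) ∈ S →
    interiorVertex S v ∨ interiorVertex S (v.1, v.2 + 1)
  noDiagOne : ∀ q ∈ S,
    ¬ (boundaryVertex S q ∧ boundaryVertex S (q.1 + 1, q.2 + 1) ∧
        interiorVertex S (q.1 + 1, q.2) ∧ interiorVertex S (q.1, q.2 + 1))
  noDiagTwo : ∀ q ∈ S,
    ¬ (boundaryVertex S (q.1 + 1, q.2) ∧ boundaryVertex S (q.1, q.2 + 1) ∧
        interiorVertex S q ∧ interiorVertex S (q.1 + 1, q.2 + 1))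

/-- The discrete `x`-derivative `∂ˣc(Q)` of a scalar vertex function on the square `Q`. -/
def dX (c : ℤ × ℤ → ℝ) (q : ℤ × ℤ) : ℝ :=
  c (q.1 + 1, q.2) + c (q.1 + 1, q.2 + 1) - c (q.1, q.2) - c (q.1, q.2 + 1)

/-- The discrete `y`-derivative `∂ʸc(Q)` of a scalar vertex function on the square `Q`. -/
def dY (c : ℤ × ℤ → ℝ) (q : ℤ × ℤ) : ℝ :=
  c (q.1, q.2 + 1) + c (q.1 + 1, q.2 + 1) - c (q.1, q.2) - c (q.1 + 1, q.2)

/-- The discrete divergence `(Dc)(Q) = ∂ˣc¹(Q) + ∂ʸc²(Q)`. -/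
def Ddiv (c : ℤ × ℤ → ℝ × ℝ) (q : ℤ × ℤ) : ℝ :=
  dX (fun v => (c v).1) q + dY (fun v => (c v).2) q

/-- The discrete curl `(Cc)(Q) = ∂ˣc²(Q) − ∂ʸc¹(Q)`. -/
def Ccurl (c : ℤ × ℤ → ℝ × ℝ) (q : ℤ × ℤ) : ℝ :=
  dX (fun v => (c v).2) q - dY (fun v => (c v).1) q

/-- The coefficient vector `c_Q` of the locally divergence-free element `Ψ_h^Q` attached to
the interior square `Q = (i,j)`: its only nonzero values are `c_Q(i+1,j+1) = (1/2,−1/2)`,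
`c_Q(i,j+1) = (1/2,1/2)`, `c_Q(i,j) = (−1/2,1/2)` and `c_Q(i+1,j) = (−1/2,−1/2)`. -/
noncomputable def cQ (q : ℤ × ℤ) : (ℤ × ℤ) → ℝ × ℝ := fun v =>
  if v = (q.1 + 1, q.2 + 1) then (1 / 2, -(1 / 2))
  else if v = (q.1, q.2 + 1) then (1 / 2, 1 / 2)
  else if v = q then (-(1 / 2), 1 / 2)
  else if v = (q.1 + 1, q.2) then (-(1 / 2), -(1 / 2))
  else (0, 0)

/-- `q'` is one of the four diagonal neighbors `(i±1, j±1)` of the square `q = (i,j)`. -/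
abbrev diagNbr (q q' : ℤ × ℤ) : Prop :=
  (q'.1 - q.1 = 1 ∨ q'.1 - q.1 = -1) ∧ (q'.2 - q.2 = 1 ∨ q'.2 - q.2 = -1)

/-- A finitely supported divergence-free pair on the diagonals of the grid has a finitely
supported stream function. -/
theorem exists_stream (p m : ℤ → ℤ → ℝ) (N : ℤ)
    (hp : ∀ i j, N < |i| ∨ N < |j| → p i j = 0)
    (hm : ∀ i j, N < |i| ∨ N < |j| → m i j = 0)
    (hdiv : ∀ i j, p (i + 1) (j + 1) - p i j + m (i + 1) j - m i (j + 1) = 0) :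
    ∃ φ : ℤ → ℤ → ℝ, (∀ i j, N < |i| ∨ N < |j| → φ i j = 0) ∧
      (∀ i j, p i j = φ i (j - 1) - φ (i - 1) j) ∧
      (∀ i j, m i j = φ (i - 1) (j - 1) - φ i j) := by
  obtain ⟨φ, hφ⟩ : ∃ φ : ℤ → ℤ → ℝ, ∀ i j,
      φ i j = -∑ t ∈ Finset.range (i + N + 1).toNat, m (i - t) (j - t) := ⟨_, fun _ _ => rfl⟩
  have hleft : ∀ i j, i < -N → φ i j = 0 := by
    intro i j hi
    rw [hφ, Int.toNat_eq_zero.2 (by omega)]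
    simp
  have hbelow : ∀ i j, j < -N → φ i j = 0 := by
    intro i j hj
    rw [hφ, Finset.sum_eq_zero, neg_zero]
    intro t _
    exact hm _ _ (Or.inr (lt_abs.2 (by omega)))
  have hmφ : ∀ i j, m i j = φ (i - 1) (j - 1) - φ i j := by
    intro i j
    by_cases hi : i < -N
    · rw [hleft i j hi, hleft (i - 1) _ (by omega), hm i j (Or.inl (lt_abs.2 (by omega))), sub_zero]
    · have hk : (i + N + 1).toNat = (i - 1 + N + 1).toNat + 1 := by omega
      rw [hφ i j, hφ (i - 1) (j - 1), hk, Finset.sum_range_succ']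
      have : ∀ t : ℕ, m (i - (t + 1 : ℕ)) (j - (t + 1 : ℕ)) = m (i - 1 - t) (j - 1 - t) := by
        intro t
        congr 1 <;> push_cast <;> ring
      simp only [this]
      simp
  have hstep : ∀ (t : ℕ) (i j : ℤ), p i j - (φ i (j - 1) - φ (i - 1) j) =
      p (i - t) (j - t) - (φ (i - t) (j - t - 1) - φ (i - t - 1) (j - t)) := by
    intro t
    induction t with
    | zero => simp
    | succ t ih =>
      intro i j
      rw [ih i j]
      have h1 := hdiv (i - t - 1) (j - t - 1)
      have h2 := hmφ (i - t) (j - t - 1)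
      have h3 := hmφ (i - t - 1) (j - t)
      have e : ∀ x : ℤ, x - ((t + 1 : ℕ) : ℤ) = x - t - 1 := by intro x; push_cast; ring
      simp only [e]
      simp only [sub_add_cancel] at h1
      linarith
  have hpφ : ∀ i j, p i j = φ i (j - 1) - φ (i - 1) j := by
    intro i j
    have h1 := hstep (i + N + 1).toNat i j
    generalize hk : (i + N + 1).toNat = k at h1
    have h2 : i - (k : ℤ) < -N := by omega
    rw [hleft (i - k) (j - k - 1) h2, hleft (i - k - 1) (j - k) (by omega),
      hp (i - k) (j - k) (Or.inl (lt_abs.2 (Or.inr (by omega))))] at h1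
    linarith
  refine ⟨φ, ?_, hpφ, hmφ⟩
  have hright : ∀ (t : ℕ) (i j : ℤ), N < i → φ i j = φ (i + t) (j - t) := by
    intro t
    induction t with
    | zero => simp
    | succ t ih =>
      intro i j hi
      have h1 := hpφ (i + t + 1) (j - t)
      rw [hp (i + t + 1) (j - t) (Or.inl (lt_abs.2 (by omega)))] at h1
      rw [ih i j hi]
      push_cast
      rw [← add_assoc, ← sub_sub]
      simp only [add_sub_cancel_right] at h1
      linarith
  have habove : ∀ (t : ℕ) (i j : ℤ), N < j → φ i j = φ (i - t) (j + t) := by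
    intro t
    induction t with
    | zero => simp
    | succ t ih =>
      intro i j hj
      have h1 := hpφ (i - t) (j + t + 1)
      rw [hp (i - t) (j + t + 1) (Or.inr (lt_abs.2 (by omega)))] at h1
      rw [ih i j hj]
      push_cast
      rw [← add_assoc, ← sub_sub]
      simp only [add_sub_cancel_right] at h1
      linarith
  intro i j hij
  simp only [lt_abs] at hij
  rcases hij with (h | h) | (h | h)
  · rw [hright (j + N + 1).toNat i j h, hbelow _ _ (by omega)]
  · exact hleft _ _ (by omega)
  · rw [habove (i + N + 1).toNat i j h, hleft _ _ (by omega)]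
  · exact hbelow _ _ (by omega)

theorem cQ_fst_add_snd (q v : ℤ × ℤ) : (cQ q v).1 + (cQ q v).2 =
    (if q = (v.1, v.2 - 1) then 1 else 0) - (if q = (v.1 - 1, v.2) then 1 else 0) := by
  obtain ⟨i, j⟩ := q
  obtain ⟨x, y⟩ := v
  simp only [cQ, Prod.mk.injEq]
  split_ifs <;> first | omega | norm_num

theorem cQ_fst_sub_snd (q v : ℤ × ℤ) : (cQ q v).1 - (cQ q v).2 =
    (if q = (v.1 - 1, v.2 - 1) then 1 else 0) - (if q = v then 1 else 0) := by
  obtain ⟨i, j⟩ := q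
  obtain ⟨x, y⟩ := v
  simp only [cQ, Prod.mk.injEq]
  split_ifs <;> first | omega | norm_num

theorem Ddiv_eq_diagonal (c : ℤ × ℤ → ℝ × ℝ) (q : ℤ × ℤ) : Ddiv c q =
    ((c (q.1 + 1, q.2 + 1)).1 + (c (q.1 + 1, q.2 + 1)).2) - ((c q).1 + (c q).2) +
      ((c (q.1 + 1, q.2)).1 - (c (q.1 + 1, q.2)).2) -
      ((c (q.1, q.2 + 1)).1 - (c (q.1, q.2 + 1)).2) := by
  simp only [Ddiv, dX, dY]
  ring

theorem Ddiv_cQ (q q' : ℤ × ℤ) : Ddiv (cQ q) q' = 0 := by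
  rw [Ddiv_eq_diagonal]
  simp only [cQ_fst_add_snd, cQ_fst_sub_snd, add_sub_cancel_right]
  ring

theorem cQ_eq_zero (S : Finset (ℤ × ℤ)) {q v : ℤ × ℤ} (hq : interiorSquare S q)
    (hv : ¬ interiorVertex S v) : cQ q v = 0 := by
  obtain ⟨h1, h2, h3, h4⟩ := hq
  unfold cQ
  split_ifs with a b c d
  · exact absurd (a ▸ h4) hv
  · exact absurd (b ▸ h3) hv
  · exact absurd (c ▸ h1) hv
  · exact absurd (d ▸ h2) hv
  · rfl

theorem linearIndependent_cQ (P : ℤ × ℤ → Prop) :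
    LinearIndependent ℝ (fun Q : {q : ℤ × ℤ // P q} => cQ Q.1) := by
  classical
  rw [linearIndependent_iff']
  intro s g hsum
  by_contra! hne
  obtain ⟨a, ha, hga⟩ := hne
  obtain ⟨b, hb, hmin⟩ := Finset.exists_min_image (s.filter fun x => g x ≠ 0) (fun x => x.1.1)
    ⟨a, Finset.mem_filter.2 ⟨ha, hga⟩⟩
  rw [Finset.mem_filter] at hb
  have h1 : ∑ x ∈ s, g x * ((cQ x.1 b.1).1 - (cQ x.1 b.1).2) = 0 := by
    have h2 := congrFun hsum b.1
    have h3 := congrArg Prod.fst h2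
    have h4 := congrArg Prod.snd h2
    simp only [Finset.sum_apply, Prod.fst_sum, Prod.snd_sum, Pi.smul_apply, Prod.smul_fst,
      Prod.smul_snd, smul_eq_mul, Pi.zero_apply, Prod.fst_zero, Prod.snd_zero] at h3 h4
    simp only [mul_sub, Finset.sum_sub_distrib, h3, h4, sub_zero]
  rw [Finset.sum_eq_single b] at h1
  · rw [cQ_fst_sub_snd, if_neg (fun h => by
      have := congrArg Prod.fst h
      simp only at this
      omega), if_pos rfl] at h1
    exact hb.2 (by linarith)
  · intro x hx hxb
    by_cases hgx : g x = 0
    · rw [hgx, zero_mul]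
    · have := hmin x (Finset.mem_filter.2 ⟨hx, hgx⟩)
      have hne : x.1 ≠ b.1 := fun h => hxb (Subtype.ext h)
      rw [cQ_fst_sub_snd, if_neg hne, if_neg, sub_zero, mul_zero]
      intro h
      rw [h] at this
      simp only at this
      omega
  · exact fun h => absurd hb.1 h

theorem int_sub_half_ne_zero (a b : ℤ) : (a : ℝ) - (b + 1 / 2) ≠ 0 := by
  intro h
  have : 2 * a = 2 * b + 1 := by exact_mod_cast (show (2 : ℝ) * a = 2 * b + 1 by linarith)
  omega

/-- Two continuous branches of the logarithm differ by a constant on a preconnected set. -/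
theorem sub_log_eq_of_isPreconnected {X : Type*} [TopologicalSpace X] {s : Set X}
    (hs : IsPreconnected s) {L g : X → ℂ} (hL : ContinuousOn L s) (hg : ContinuousOn g s)
    (hexp : ∀ x ∈ s, Complex.exp (L x) = g x) (hslit : ∀ x ∈ s, g x ∈ Complex.slitPlane)
    {x y : X} (hx : x ∈ s) (hy : y ∈ s) :
    L x - Complex.log (g x) = L y - Complex.log (g y) := by
  have hone : ∀ z ∈ s, Complex.exp (L z - Complex.log (g z)) = 1 := by
    intro z hz
    have h0 := Complex.slitPlane_ne_zero (hslit z hz)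
    rw [Complex.exp_sub, Complex.exp_log h0, hexp z hz, div_self h0]
  refine Complex.isCoveringMap_exp.constOn_of_comp hs (hL.sub (hg.clog hslit)) ?_ hx hy
  intro a ha b hb
  exact Subtype.ext ((hone a ha).trans (hone b hb).symm)

theorem mem_interior_meshRegion (S : Finset (ℤ × ℤ)) {v : ℤ × ℤ} (hv : interiorVertex S v)
    {p : ℝ × ℝ} (h1 : (v.1 : ℝ) - 1 < p.1) (h2 : p.1 < v.1 + 1) (h3 : (v.2 : ℝ) - 1 < p.2)
    (h4 : p.2 < v.2 + 1) : p ∈ interior (meshRegion S) := by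
  refine interior_maximal (s := meshRegion S)
    (t := Set.Ioo ((v.1 : ℝ) - 1) (v.1 + 1) ×ˢ Set.Ioo ((v.2 : ℝ) - 1) (v.2 + 1)) ?_
    (isOpen_Ioo.prod isOpen_Ioo) ⟨⟨h1, h2⟩, ⟨h3, h4⟩⟩
  rintro ⟨x, y⟩ ⟨⟨hx1, hx2⟩, hy1, hy2⟩
  simp only at hx1 hx2 hy1 hy2
  have fx1 : v.1 - 1 ≤ ⌊x⌋ := Int.le_floor.2 (by push_cast; linarith)
  have fx2 : ⌊x⌋ < v.1 + 1 := Int.floor_lt.2 (by push_cast; linarith)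
  have fy1 : v.2 - 1 ≤ ⌊y⌋ := Int.le_floor.2 (by push_cast; linarith)
  have fy2 : ⌊y⌋ < v.2 + 1 := Int.floor_lt.2 (by push_cast; linarith)
  have hS : (⌊x⌋, ⌊y⌋) ∈ S := by
    obtain ⟨a, b, c, d⟩ := hv
    have ex : ⌊x⌋ = v.1 - 1 ∨ ⌊x⌋ = v.1 := by omega
    have ey : ⌊y⌋ = v.2 - 1 ∨ ⌊y⌋ = v.2 := by omega
    rcases ex with ex | ex <;> rcases ey with ey | ey <;> rw [ex, ey] <;> assumption
  simp only [meshRegion, Set.mem_iUnion]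
  exact ⟨_, hS, ⟨Int.floor_le x, (Int.lt_floor_add_one x).le⟩,
    ⟨Int.floor_le y, (Int.lt_floor_add_one y).le⟩⟩

theorem center_notMem_meshRegion (S : Finset (ℤ × ℤ)) {q : ℤ × ℤ} (hq : q ∉ S) :
    ((q.1 + 1 / 2 : ℝ), (q.2 + 1 / 2 : ℝ)) ∉ meshRegion S := by
  simp only [meshRegion, Set.mem_iUnion, not_exists]
  rintro r hr ⟨⟨h1, h2⟩, h3, h4⟩
  simp only at h1 h2 h3 h4
  have a1 : r.1 < q.1 + 1 := by exact_mod_cast (show (r.1 : ℝ) < q.1 + 1 by linarith)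
  have a2 : q.1 < r.1 + 1 := by exact_mod_cast (show (q.1 : ℝ) < r.1 + 1 by linarith)
  have a3 : r.2 < q.2 + 1 := by exact_mod_cast (show (r.2 : ℝ) < q.2 + 1 by linarith)
  have a4 : q.2 < r.2 + 1 := by exact_mod_cast (show (q.2 : ℝ) < r.2 + 1 by linarith)
  have : r = q := Prod.ext (by omega) (by omega)
  exact hq (this ▸ hr)

/-- On a simply connected mesh, the angle form around the centre of a square outside the mesh
is exact on the graph of interior vertices, up to its jump along a horizontal ray. -/
theorem exists_angle_potential (S : Finset (ℤ × ℤ))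
    (hS : SimplyConnectedSpace ↥(interior (meshRegion S))) {q : ℤ × ℤ} (hq : q ∉ S) :
    ∃ f : ℤ × ℤ → ℝ,
      (∀ v : ℤ × ℤ, interiorVertex S v → interiorVertex S (v.1 + 1, v.2) →
        f (v.1 + 1, v.2) = f v) ∧
      (∀ v : ℤ × ℤ, interiorVertex S v → interiorVertex S (v.1, v.2 + 1) →
        f (v.1, v.2 + 1) = f v - if v.2 = q.2 ∧ v.1 ≤ q.1 then 2 * Real.pi else 0) := by
  obtain ⟨g, hg⟩ : ∃ g : ℝ × ℝ → ℂ, ∀ p, g p =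
      ((p.1 - (q.1 + 1 / 2) : ℝ) : ℂ) + ((p.2 - (q.2 + 1 / 2) : ℝ) : ℂ) * Complex.I :=
    ⟨_, fun _ => rfl⟩
  have hre : ∀ p, (g p).re = p.1 - (q.1 + 1 / 2) := by intro p; rw [hg]; simp
  have him : ∀ p, (g p).im = p.2 - (q.2 + 1 / 2) := by intro p; rw [hg]; simp
  have hgc : Continuous g := by
    rw [funext hg]
    fun_prop
  obtain ⟨L, hLc, hL⟩ := Complex.exists_continuousOn_eqOn_exp_comp (U := interior (meshRegion S))
    hS isOpen_interior hgc.continuousOn (by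
      rintro ⟨p, hp, h0⟩
      refine center_notMem_meshRegion S hq ?_
      have h1 := hre p
      have h2 := him p
      rw [h0] at h1 h2
      simp only [Complex.zero_re, Complex.zero_im] at h1 h2
      have : p = ((q.1 + 1 / 2 : ℝ), (q.2 + 1 / 2 : ℝ)) :=
        Prod.ext (by simp only; linarith) (by simp only; linarith)
      exact this ▸ interior_subset hp)
  have key : ∀ s : Set (ℝ × ℝ), IsPreconnected s → s ⊆ interior (meshRegion S) →
      (∀ p ∈ s, g p ∈ Complex.slitPlane) → ∀ x ∈ s, ∀ y ∈ s,
      (L x).im - (g x).arg = (L y).im - (g y).arg := by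
    intro s hs hsub hslit x hx y hy
    have := congrArg Complex.im (sub_log_eq_of_isPreconnected hs (hLc.mono hsub) hgc.continuousOn
      (fun z hz => hL (hsub hz)) hslit hx hy)
    simpa [Complex.log_im] using this
  have key' : ∀ s : Set (ℝ × ℝ), IsPreconnected s → s ⊆ interior (meshRegion S) →
      (∀ p ∈ s, -g p ∈ Complex.slitPlane) → ∀ x ∈ s, ∀ y ∈ s,
      (L x).im - (-g x).arg = (L y).im - (-g y).arg := by
    intro s hs hsub hslit x hx y hy
    have := congrArg Complex.im (sub_log_eq_of_isPreconnected hs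
      (L := fun z => L z + Real.pi * Complex.I) ((hLc.mono hsub).add continuousOn_const)
      hgc.neg.continuousOn
      (fun z hz => by
        rw [Complex.exp_add, Complex.exp_pi_mul_I, mul_neg_one]
        exact congrArg _ (hL (hsub hz))) hslit hx hy)
    simp only [Complex.sub_im, Complex.add_im, Complex.log_im, Pi.neg_apply] at this
    linarith
  refine ⟨fun v => (L (v.1, v.2)).im - (g (v.1, v.2)).arg, ?_, ?_⟩
  · intro v hv hv'
    refine key (Set.Icc (v.1 : ℝ) (v.1 + 1) ×ˢ {(v.2 : ℝ)})
      (isPreconnected_Icc.prod isPreconnected_singleton) ?_ ?_ _ (by simp) _ (by simp)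
    · rintro ⟨x, y⟩ ⟨⟨h1, h2⟩, h3⟩
      simp only [Set.mem_singleton_iff] at h1 h2 h3
      subst h3
      rcases h2.lt_or_eq with h | h
      · exact mem_interior_meshRegion S hv (by simp only; linarith) h (by simp) (by simp)
      · exact mem_interior_meshRegion S (v := (v.1 + 1, v.2)) hv' (by simp only; push_cast; linarith)
          (by simp only; push_cast; linarith) (by simp) (by simp)
    · rintro ⟨x, y⟩ ⟨-, h3⟩
      simp only [Set.mem_singleton_iff] at h3
      refine Or.inr ?_
      rw [him]
      simp only [h3]
      exact int_sub_half_ne_zero _ _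
  · intro v hv hv'
    have hsub : ({(v.1 : ℝ)} : Set ℝ) ×ˢ Set.Icc (v.2 : ℝ) (v.2 + 1) ⊆
        interior (meshRegion S) := by
      rintro ⟨x, y⟩ ⟨h3, ⟨h1, h2⟩⟩
      simp only [Set.mem_singleton_iff] at h1 h2 h3
      subst h3
      rcases h2.lt_or_eq with h | h
      · exact mem_interior_meshRegion S hv (by simp) (by simp) (by simp only; linarith) h
      · exact mem_interior_meshRegion S (v := (v.1, v.2 + 1)) hv' (by simp) (by simp) (by simp only; push_cast; linarith)
          (by simp only; push_cast; linarith)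
    have hpre : IsPreconnected (({(v.1 : ℝ)} : Set ℝ) ×ˢ Set.Icc (v.2 : ℝ) (v.2 + 1)) :=
      isPreconnected_singleton.prod isPreconnected_Icc
    split_ifs with hcut
    · have hneg : (v.1 : ℝ) ≤ q.1 := by exact_mod_cast hcut.2
      have h := key' _ hpre hsub (by
        rintro ⟨x, y⟩ ⟨h3, -⟩
        simp only [Set.mem_singleton_iff] at h3
        refine Or.inl ?_
        rw [Complex.neg_re, hre]
        simp only [h3]
        linarith) ((v.1 : ℝ), (v.2 : ℝ) + 1) (by simp) ((v.1 : ℝ), (v.2 : ℝ)) (by simp)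
      have hq2 : (v.2 : ℝ) = q.2 := by exact_mod_cast hcut.1
      rw [Complex.arg_neg_eq_arg_sub_pi_of_im_pos (by rw [him]; simp only; linarith),
        Complex.arg_neg_eq_arg_add_pi_of_im_neg (by rw [him]; simp only; linarith)] at h
      push_cast
      linarith
    · rw [sub_zero]
      push_cast
      refine key _ hpre hsub ?_ _ (by simp) _ (by simp)
      rintro ⟨x, y⟩ ⟨h3, ⟨h1, h2⟩⟩
      simp only [Set.mem_singleton_iff] at h1 h2 h3
      by_cases hx : v.1 ≤ q.1
      · refine Or.inr ?_
        rw [him]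
        simp only
        rcases lt_trichotomy v.2 q.2 with hlt | heq | hgt
        · have : (v.2 : ℝ) + 1 ≤ q.2 := by exact_mod_cast hlt
          exact ne_of_lt (by linarith)
        · exact absurd ⟨heq, hx⟩ hcut
        · have : (q.2 : ℝ) + 1 ≤ v.2 := by exact_mod_cast hgt
          exact ne_of_gt (by linarith)
      · refine Or.inl ?_
        have : (q.1 : ℝ) + 1 ≤ v.1 := by exact_mod_cast (show q.1 + 1 ≤ v.1 by omega)
        rw [hre]
        simp only [h3]
        linarith

theorem finsum_shift_sub {u : ℤ × ℤ → ℝ} (hu : (Function.support u).Finite) (a b : ℤ) :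
    ∑ᶠ v : ℤ × ℤ, (u (v.1 + a, v.2 + b) - u v) = 0 := by
  have e : ∀ v : ℤ × ℤ, u (v.1 + a, v.2 + b) = u (Equiv.addRight ((a, b) : ℤ × ℤ) v) :=
    fun _ => rfl
  have hu' : (Function.support fun v => u (Equiv.addRight ((a, b) : ℤ × ℤ) v)).Finite :=
    hu.preimage (Equiv.injective _).injOn
  simp only [e]
  rw [finsum_sub_distrib hu' hu, finsum_comp_equiv, sub_self]

/-- On a simply connected mesh, a finite set of non-interior vertices that is closed under
passing to non-interior corners of a common square is empty. -/
theorem notMem_of_finite_of_closed (S : Finset (ℤ × ℤ))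
    (hS : SimplyConnectedSpace ↥(interior (meshRegion S))) {K : Set (ℤ × ℤ)} (hK : K.Finite)
    (hKS : ∀ v ∈ K, ¬ interiorVertex S v)
    (hclosed : ∀ v w : ℤ × ℤ, v ∈ K → ¬ interiorVertex S w → |w.1 - v.1| ≤ 1 → |w.2 - v.2| ≤ 1 →
      w ∈ K) (k : ℤ × ℤ) : k ∉ K := by
  classical
  intro hk
  obtain ⟨q, hq, hqk⟩ : ∃ q : ℤ × ℤ, q ∉ S ∧
      (k = q ∨ k = (q.1 + 1, q.2) ∨ k = (q.1, q.2 + 1) ∨ k = (q.1 + 1, q.2 + 1)) := by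
    have h := hKS k hk
    by_contra! hno
    refine h ⟨?_, ?_, ?_, ?_⟩ <;> by_contra hn
    · exact (hno _ hn).2.2.2 (by simp)
    · exact (hno _ hn).2.1 (by simp)
    · exact (hno _ hn).2.2.1 (by simp)
    · exact (hno _ hn).1 rfl
  obtain ⟨f, hfx, hfy⟩ := exists_angle_potential S hS hq
  obtain ⟨gx, hgx⟩ : ∃ gx : ℤ × ℤ → ℝ, ∀ v, gx v =
      if v ∈ K ∨ (v.1 + 1, v.2) ∈ K then f (v.1 + 1, v.2) - f v else 0 := ⟨_, fun _ => rfl⟩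
  obtain ⟨gy, hgy⟩ : ∃ gy : ℤ × ℤ → ℝ, ∀ v, gy v =
      if v ∈ K ∨ (v.1, v.2 + 1) ∈ K then f (v.1, v.2 + 1) - f v +
        (if v.2 = q.2 ∧ v.1 ≤ q.1 then 2 * Real.pi else 0) else 0 := ⟨_, fun _ => rfl⟩
  have hgxs : (Function.support gx).Finite := by
    refine (hK.union (hK.image fun v => (v.1 - 1, v.2))).subset ?_
    intro v hv
    rw [Function.mem_support, hgx] at hv
    rcases of_not_not fun h => hv (if_neg h) with h | h
    · exact Or.inl h
    · exact Or.inr ⟨_, h, by simp⟩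
  have hgys : (Function.support gy).Finite := by
    refine (hK.union (hK.image fun v => (v.1, v.2 - 1))).subset ?_
    intro v hv
    rw [Function.mem_support, hgy] at hv
    rcases of_not_not fun h => hv (if_neg h) with h | h
    · exact Or.inl h
    · exact Or.inr ⟨_, h, by simp⟩
  have hgx' : ∀ v, (v ∈ K ∨ interiorVertex S v) →
      ((v.1 + 1, v.2) ∈ K ∨ interiorVertex S (v.1 + 1, v.2)) → gx v = f (v.1 + 1, v.2) - f v := by
    intro v h1 h2
    rw [hgx]
    split_ifs with h
    · rfl
    · rw [hfx v (h1.resolve_left fun h' => h (Or.inl h'))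
        (h2.resolve_left fun h' => h (Or.inr h')), sub_self]
  have hgy' : ∀ v, (v ∈ K ∨ interiorVertex S v) →
      ((v.1, v.2 + 1) ∈ K ∨ interiorVertex S (v.1, v.2 + 1)) → gy v = f (v.1, v.2 + 1) - f v +
        (if v.2 = q.2 ∧ v.1 ≤ q.1 then 2 * Real.pi else 0) := by
    intro v h1 h2
    rw [hgy]
    split_ifs with h h3 h3
    · rfl
    · rfl
    · rw [hfy v (h1.resolve_left fun h' => h (Or.inl h'))
        (h2.resolve_left fun h' => h (Or.inr h')), if_pos h3]
      ring
    · rw [hfy v (h1.resolve_left fun h' => h (Or.inl h'))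
        (h2.resolve_left fun h' => h (Or.inr h')), if_neg h3]
      ring
  have hcurl : ∀ v : ℤ × ℤ, (gy (v.1 + 1, v.2) - gy v) - (gx (v.1, v.2 + 1) - gx v) =
      if v = q then -(2 * Real.pi) else 0 := by
    intro v
    by_cases hv : ∃ w ∈ K, (v.1 ≤ w.1 ∧ w.1 ≤ v.1 + 1) ∧ (v.2 ≤ w.2 ∧ w.2 ≤ v.2 + 1)
    · obtain ⟨w, hw, ⟨hw1, hw2⟩, hw3, hw4⟩ := hv
      have hcorner : ∀ x y : ℤ, v.1 ≤ x → x ≤ v.1 + 1 → v.2 ≤ y → y ≤ v.2 + 1 →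
          (x, y) ∈ K ∨ interiorVertex S (x, y) := by
        intro x y h1 h2 h3 h4
        by_cases hi : interiorVertex S (x, y)
        · exact Or.inr hi
        · exact Or.inl (hclosed w _ hw hi (abs_le.2 (by simp only; omega))
            (abs_le.2 (by simp only; omega)))
      have c00 := hcorner v.1 v.2 (by omega) (by omega) (by omega) (by omega)
      have c10 := hcorner (v.1 + 1) v.2 (by omega) (by omega) (by omega) (by omega)
      have c01 := hcorner v.1 (v.2 + 1) (by omega) (by omega) (by omega) (by omega)
      have c11 := hcorner (v.1 + 1) (v.2 + 1) (by omega) (by omega) (by omega) (by omega)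
      rw [hgx' v c00 c10, hgx' (v.1, v.2 + 1) c01 c11, hgy' v c00 c01,
        hgy' (v.1 + 1, v.2) c10 c11]
      simp only [Prod.ext_iff]
      split_ifs <;> first | omega | ring
    · have hn : ∀ x y : ℤ, v.1 ≤ x → x ≤ v.1 + 1 → v.2 ≤ y → y ≤ v.2 + 1 → (x, y) ∉ K :=
        fun x y h1 h2 h3 h4 h => hv ⟨_, h, ⟨h1, h2⟩, h3, h4⟩
      have n00 : v ∉ K := hn v.1 v.2 (by omega) (by omega) (by omega) (by omega)
      have n10 := hn (v.1 + 1) v.2 (by omega) (by omega) (by omega) (by omega)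
      have n01 := hn v.1 (v.2 + 1) (by omega) (by omega) (by omega) (by omega)
      have n11 := hn (v.1 + 1) (v.2 + 1) (by omega) (by omega) (by omega) (by omega)
      have hvq : v ≠ q := by
        rintro rfl
        rcases hqk with h | h | h | h <;> rw [h] at hk <;> contradiction
      simp only [hgx, hgy, n00, n10, n01, n11, hvq, or_self, if_false, sub_self]
  have hsum : ∑ᶠ v : ℤ × ℤ, ((gy (v.1 + 1, v.2) - gy v) - (gx (v.1, v.2 + 1) - gx v)) = 0 := by
    have h1 := finsum_shift_sub hgys 1 0
    have h2 := finsum_shift_sub hgxs 0 1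
    simp only [add_zero] at h1 h2
    have s1 : (Function.support fun v : ℤ × ℤ => gy (v.1 + 1, v.2) - gy v).Finite :=
      ((hgys.preimage (f := Equiv.addRight ((1, 0) : ℤ × ℤ)) (Equiv.injective _).injOn).union
        hgys).subset fun v hv => by
          by_contra hno
          simp only [Set.mem_union, Set.mem_preimage, Function.mem_support, not_or, not_not,
            Equiv.coe_addRight, Prod.add_def, add_zero] at hno
          exact hv (by simp only [hno, sub_self])
    have s2 : (Function.support fun v : ℤ × ℤ => gx (v.1, v.2 + 1) - gx v).Finite :=
      ((hgxs.preimage (f := Equiv.addRight ((0, 1) : ℤ × ℤ)) (Equiv.injective _).injOn).union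
        hgxs).subset fun v hv => by
          by_contra hno
          simp only [Set.mem_union, Set.mem_preimage, Function.mem_support, not_or, not_not,
            Equiv.coe_addRight, Prod.add_def, add_zero] at hno
          exact hv (by simp only [hno, sub_self])
    rw [finsum_sub_distrib s1 s2, h1, h2, sub_self]
  rw [finsum_congr hcurl, finsum_eq_single _ q fun v hv => if_neg hv, if_pos rfl] at hsum
  linarith [Real.pi_pos]

theorem sum_smul_cQ_eq {F : Finset (ℤ × ℤ)} {φ : ℤ × ℤ → ℝ} (hφ : ∀ q, q ∉ F → φ q = 0)
    {c : ℤ × ℤ → ℝ × ℝ}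
    (hp : ∀ v, (c v).1 + (c v).2 = φ (v.1, v.2 - 1) - φ (v.1 - 1, v.2))
    (hm : ∀ v, (c v).1 - (c v).2 = φ (v.1 - 1, v.2 - 1) - φ v) :
    ∑ q ∈ F, φ q • cQ q = c := by
  have hF : ∀ a, (∑ q ∈ F, φ q * if q = a then 1 else 0) = φ a := by
    intro a
    simp only [mul_ite, mul_one, mul_zero, Finset.sum_ite_eq']
    split_ifs with h
    · rfl
    · exact (hφ a h).symm
  funext v
  have h1 : ∑ q ∈ F, φ q * ((cQ q v).1 + (cQ q v).2) = (c v).1 + (c v).2 := by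
    simp only [cQ_fst_add_snd, mul_sub, Finset.sum_sub_distrib, hF, hp]
  have h2 : ∑ q ∈ F, φ q * ((cQ q v).1 - (cQ q v).2) = (c v).1 - (c v).2 := by
    simp only [cQ_fst_sub_snd, mul_sub, Finset.sum_sub_distrib, hF, hm]
  simp only [mul_add, Finset.sum_add_distrib] at h1
  simp only [mul_sub, Finset.sum_sub_distrib] at h2
  ext <;> simp only [Finset.sum_apply, Pi.smul_apply, Prod.fst_sum, Prod.snd_sum, Prod.smul_fst,
    Prod.smul_snd, smul_eq_mul] <;> linarith

/-- A finitely supported function on the squares whose values agree across every non-interior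
vertex vanishes on the squares that are not interior. -/
theorem eq_zero_of_not_interiorSquare {S : Finset (ℤ × ℤ)} (h : Standing S) {φ : ℤ × ℤ → ℝ}
    (hfin : (Function.support φ).Finite)
    (hp : ∀ v, ¬ interiorVertex S v → φ (v.1, v.2 - 1) = φ (v.1 - 1, v.2))
    (hm : ∀ v, ¬ interiorVertex S v → φ (v.1 - 1, v.2 - 1) = φ v)
    {q : ℤ × ℤ} (hq : ¬ interiorSquare S q) : φ q = 0 := by
  obtain ⟨K, hK⟩ : ∃ K : Set (ℤ × ℤ), ∀ v, v ∈ K ↔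
      ¬ interiorVertex S v ∧ (φ v ≠ 0 ∨ φ (v.1, v.2 - 1) ≠ 0) :=
    ⟨{v | _}, fun _ => Iff.rfl⟩
  have hKfin : K.Finite := by
    refine (hfin.union (hfin.image fun v => (v.1, v.2 + 1))).subset ?_
    intro v hv
    rcases ((hK v).1 hv).2 with h1 | h1
    · exact Or.inl h1
    · exact Or.inr ⟨_, h1, by simp⟩
  have hright : ∀ x y : ℤ, ¬ interiorVertex S (x, y) → ¬ interiorVertex S (x + 1, y) →
      ((x, y) ∈ K ↔ (x + 1, y) ∈ K) := by
    intro x y h1 h2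
    have a1 := hp _ h2
    have a2 := hm _ h2
    simp only [add_sub_cancel_right] at a1 a2
    rw [hK, hK, ← a2, a1, and_iff_right h1, and_iff_right h2, or_comm]
  have hup : ∀ x y : ℤ, ¬ interiorVertex S (x, y) → ¬ interiorVertex S (x, y + 1) →
      ((x, y) ∈ K ↔ (x, y + 1) ∈ K) := by
    intro x y h1 h2
    have a1 := hp _ h1
    have a2 := hp _ h2
    have a3 := hm _ h2
    simp only [add_sub_cancel_right] at a1 a2 a3
    rw [hK, hK, ← a3, a1]
    simp only [add_sub_cancel_right]
    rw [and_iff_right h1, and_iff_right h2, or_comm]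
  have hdiag : ∀ x y : ℤ, ¬ interiorVertex S (x, y) → ¬ interiorVertex S (x + 1, y + 1) →
      ((x, y) ∈ K ↔ (x + 1, y + 1) ∈ K) := by
    intro x y h1 h2
    by_cases h3 : interiorVertex S (x + 1, y)
    · by_cases h4 : interiorVertex S (x, y + 1)
      · have hS : (x, y) ∈ S := by simpa using h3.2.1
        refine absurd ⟨⟨?_, h1⟩, ⟨?_, h2⟩, h3, h4⟩ (h.noDiagOne (x, y) hS)
        · exact Or.inr (Or.inr (Or.inr hS))
        · exact Or.inl (by simpa using hS)
      · rw [hup x y h1 h4, hright x (y + 1) h4 h2]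
    · rw [hright x y h1 h3, hup (x + 1) y h3 h2]
  have hanti : ∀ x y : ℤ, ¬ interiorVertex S (x + 1, y) → ¬ interiorVertex S (x, y + 1) →
      ((x + 1, y) ∈ K ↔ (x, y + 1) ∈ K) := by
    intro x y h1 h2
    by_cases h3 : interiorVertex S (x, y)
    · by_cases h4 : interiorVertex S (x + 1, y + 1)
      · have hS : (x, y) ∈ S := h3.2.2.2
        refine absurd ⟨⟨?_, h1⟩, ⟨?_, h2⟩, h3, h4⟩ (h.noDiagTwo (x, y) hS)
        · exact Or.inr (Or.inl (by simpa using hS))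
        · exact Or.inr (Or.inr (Or.inl (by simpa using hS)))
      · rw [hup (x + 1) y h1 h4, hright x (y + 1) h2 h4]
    · rw [← hright x y h3 h1, hup x y h3 h2]
  have hempty := notMem_of_finite_of_closed S h.simplyConnected hKfin
    (fun v hv => ((hK v).1 hv).1) (by
      rintro ⟨x, y⟩ ⟨z, w⟩ hv hw h1 h2
      have hv' := ((hK _).1 hv).1
      rw [abs_le] at h1 h2
      simp only at h1 h2
      have hz : z = x - 1 ∨ z = x ∨ z = x + 1 := by omega
      have hw' : w = y - 1 ∨ w = y ∨ w = y + 1 := by omega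
      rcases hz with rfl | rfl | rfl <;> rcases hw' with rfl | rfl | rfl
      · exact (hdiag (x - 1) (y - 1) hw (by simpa using hv')).2 (by simpa using hv)
      · exact (hright (x - 1) w hw (by simpa using hv')).2 (by simpa using hv)
      · exact (hanti (x - 1) y (by simpa using hv') hw).1 (by simpa using hv)
      · exact (hup z (y - 1) hw (by simpa using hv')).2 (by simpa using hv)
      · exact hv
      · exact (hup z y hv' hw).1 hv
      · exact (hanti x (y - 1) hw (by simpa using hv')).2 (by simpa using hv)
      · exact (hright x w hv' hw).1 hv
      · exact (hdiag x y hv' hw).1 hv)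
  have hzero : ∀ v, ¬ interiorVertex S v → φ v = 0 ∧ φ (v.1, v.2 - 1) = 0 := by
    intro v hv
    have := hempty v
    rw [hK, and_iff_right hv, not_or, not_not, not_not] at this
    exact this
  simp only [interiorSquare, not_and_or] at hq
  rcases hq with hq | hq | hq | hq
  · exact (hzero q (by simpa only [interiorVertex, not_and_or] using hq)).1
  · have hv : ¬ interiorVertex S (q.1 + 1, q.2) := by
      simpa only [interiorVertex, not_and_or] using hq
    simpa using (hp _ hv).symm.trans (hzero _ hv).2
  · have hv : ¬ interiorVertex S (q.1, q.2 + 1) := by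
      simpa only [interiorVertex, not_and_or] using hq
    simpa using (hzero _ hv).2
  · have hv : ¬ interiorVertex S (q.1 + 1, q.2 + 1) := by
      simpa only [interiorVertex, not_and_or] using hq
    simpa using (hm _ hv).trans (hzero _ hv).1

theorem exists_abs_bound (S : Finset (ℤ × ℤ)) :
    ∃ N : ℤ, ∀ v ∈ S, |v.1| ≤ N ∧ |v.2| ≤ N := by
  obtain ⟨N, hN⟩ := (S.finite_toSet.image fun v : ℤ × ℤ => max |v.1| |v.2|).bddAbove
  exact ⟨N, fun v hv => max_le_iff.1 (hN ⟨v, hv, rfl⟩)⟩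

theorem Ddiv_eq_zero_of_notMem {S : Finset (ℤ × ℤ)} {c : ℤ × ℤ → ℝ × ℝ}
    (hc : ∀ v : ℤ × ℤ, ¬ interiorVertex S v → c v = 0) {q : ℤ × ℤ} (hq : q ∉ S) :
    Ddiv c q = 0 := by
  rw [Ddiv_eq_diagonal, hc q fun h => hq h.2.2.2,
    hc (q.1 + 1, q.2) fun h => hq (by simpa using h.2.1),
    hc (q.1, q.2 + 1) fun h => hq (by simpa using h.2.2.1),
    hc (q.1 + 1, q.2 + 1) fun h => hq (by simpa using h.1)]
  simp

/-- Under the standing assumptions, the family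
`{c_Q : Q is an interior square of S}` is a basis of the kernel of the linear map `c ↦ Dc` on
the space of functions `c : ℤ × ℤ → ℝ × ℝ` supported on the interior vertices: these functions
are linearly independent and span
`{c supported on the interior vertices : (Dc)(Q') = 0 for every square Q' of S}`. -/
theorem cQ_basis (S : Finset (ℤ × ℤ)) (h : Standing S) :
    LinearIndependent ℝ
        (fun Q : {q : ℤ × ℤ // q ∈ S ∧ interiorSquare S q} => cQ Q.1) ∧
      (Submodule.span ℝ
          (Set.range fun Q : {q : ℤ × ℤ // q ∈ S ∧ interiorSquare S q} => cQ Q.1) :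
            Set ((ℤ × ℤ) → ℝ × ℝ)) =
        {c : (ℤ × ℤ) → ℝ × ℝ |
          (∀ v : ℤ × ℤ, ¬ interiorVertex S v → c v = 0) ∧ ∀ q ∈ S, Ddiv c q = 0} := by
  classical
  refine ⟨linearIndependent_cQ _, Set.Subset.antisymm ?_ ?_⟩
  · intro c hc
    refine Submodule.span_induction (p := fun c _ =>
      (∀ v : ℤ × ℤ, ¬ interiorVertex S v → c v = 0) ∧ ∀ q ∈ S, Ddiv c q = 0) ?_ ?_ ?_ ?_ hc
    · rintro _ ⟨Q, rfl⟩
      exact ⟨fun v hv => cQ_eq_zero S Q.2.2 hv, fun q _ => Ddiv_cQ _ _⟩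
    · exact ⟨fun _ _ => rfl, fun q _ => by simp [Ddiv_eq_diagonal]⟩
    · rintro a b - - ⟨ha, ha'⟩ ⟨hb, hb'⟩
      refine ⟨fun v hv => by rw [Pi.add_apply, ha v hv, hb v hv, add_zero], fun q hq => ?_⟩
      have h1 := ha' q hq
      have h2 := hb' q hq
      simp only [Ddiv_eq_diagonal, Pi.add_apply, Prod.fst_add, Prod.snd_add] at h1 h2 ⊢
      linarith
    · rintro r a - ⟨ha, ha'⟩
      refine ⟨fun v hv => by rw [Pi.smul_apply, ha v hv, smul_zero], fun q hq => ?_⟩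
      have h1 := congrArg (r * ·) (ha' q hq)
      simp only [Ddiv_eq_diagonal, Pi.smul_apply, Prod.smul_fst, Prod.smul_snd,
        smul_eq_mul] at h1 ⊢
      linarith
  · rintro c ⟨hc, hdiv⟩
    obtain ⟨N, hN⟩ := exists_abs_bound S
    have hfar : ∀ i j : ℤ, N < |i| ∨ N < |j| → c (i, j) = 0 := by
      intro i j hij
      refine hc _ fun hv => ?_
      have := hN (i, j) hv.2.2.2
      simp only at this
      rcases hij with h1 | h1 <;> omega
    obtain ⟨φ, hφ, hp, hm⟩ := exists_stream (fun i j => (c (i, j)).1 + (c (i, j)).2)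
      (fun i j => (c (i, j)).1 - (c (i, j)).2) N
      (fun i j hij => by simp [hfar i j hij]) (fun i j hij => by simp [hfar i j hij])
      (fun i j => by
        have h1 : Ddiv c (i, j) = 0 := by
          by_cases hS : (i, j) ∈ S
          · exact hdiv _ hS
          · exact Ddiv_eq_zero_of_notMem hc hS
        rw [Ddiv_eq_diagonal] at h1
        exact h1)
    have hfin : (Function.support fun q : ℤ × ℤ => φ q.1 q.2).Finite := by
      refine ((Set.finite_Icc (-N) N).prod (Set.finite_Icc (-N) N)).subset ?_
      intro q hq
      by_contra hno
      refine hq (hφ _ _ ?_)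
      simp only [Set.mem_prod, Set.mem_Icc, ← abs_le, not_and_or, not_le] at hno
      exact hno
    have hsum := sum_smul_cQ_eq (F := S.filter (interiorSquare S)) (φ := fun q => φ q.1 q.2)
      (c := c) (fun q hq => eq_zero_of_not_interiorSquare h hfin
        (fun v hv => by
          have := hp v.1 v.2
          simp only [Prod.mk.eta, hc v hv] at this
          simp only [Prod.fst_zero, Prod.snd_zero] at this
          linarith)
        (fun v hv => by
          have := hm v.1 v.2
          simp only [Prod.mk.eta, hc v hv] at this
          simp only [Prod.fst_zero, Prod.snd_zero] at this
          linarith)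
        (fun hint => hq (Finset.mem_filter.2 ⟨hint.1.2.2.2, hint⟩)))
      (fun v => hp v.1 v.2) (fun v => hm v.1 v.2)
    rw [← hsum]
    refine Submodule.sum_mem _ fun q hq => Submodule.smul_mem _ _ (Submodule.subset_span ?_)
    exact ⟨⟨q, Finset.mem_filter.1 hq⟩, rfl⟩
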